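/- Let S be a measurable space, let ν be a probability measure on S, let α ∈ ℝ with α ≠ 0 and α ≠ 1, and let g : S → ℝ be bounded and measurable. Then (1/α) log ∫_S e^{αg} dν = sup over all probability measures θ on S of [ (1/(α−1)) log ∫_S e^{(α−1)g} dθ − R_α(θ‖ν) ]. -/

import Mathlib

open MeasureTheory Real ProbabilityTheory
open scoped Classical

/-- Rényi divergence of order `α > 0`, `α ≠ 1`, of `ν` from `θ`, defined using densities with
respect to the dominating measure `ν + θ`. -/
noncomputable def renyiDivAux {S : Type*} [MeasurableSpace S] (α : ℝ)
    (ν θ : Measure S) : EReal :=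
  if 1 < α ∧ ¬ ν ≪ θ then ⊤
  else ((α * (α - 1))⁻¹ : ℝ) *
    ENNReal.log (∫⁻ x in {x | 0 < ν.rnDeriv (ν + θ) x ∧ 0 < θ.rnDeriv (ν + θ) x},
      (ν.rnDeriv (ν + θ) x / θ.rnDeriv (ν + θ) x) ^ α ∂θ)

/-- Rényi divergence of order `α ∈ ℝ \ {0, 1}`, extended to negative orders by
`R_α(ν‖θ) = R_{1-α}(θ‖ν)`. -/
noncomputable def renyiDiv {S : Type*} [MeasurableSpace S] (α : ℝ)
    (ν θ : Measure S) : EReal :=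
  if α < 0 then renyiDivAux (1 - α) θ ν else renyiDivAux α ν θ

lemma integrable_exp_mul_of_bounded {S : Type*} [MeasurableSpace S] (μ : Measure S)
    [IsFiniteMeasure μ] {g : S → ℝ} (hg : Measurable g) (hgbd : ∃ C : ℝ, ∀ x, |g x| ≤ C) (t : ℝ) :
    Integrable (fun x ↦ Real.exp (t * g x)) μ := by
  obtain ⟨C, hC⟩ := hgbd
  refine Integrable.of_bound (by fun_prop) (Real.exp (|t| * C)) (ae_of_all _ fun x ↦ ?_)
  rw [Real.norm_eq_abs, Real.abs_exp, Real.exp_le_exp]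
  calc t * g x ≤ |t * g x| := le_abs_self _
    _ = |t| * |g x| := abs_mul _ _
    _ ≤ |t| * C := by gcongr; exact hC x

/-- The Hellinger-type integral in `renyiDivAux` is an integral of the power of `dθ/dν`. -/
lemma setLIntegral_rnDeriv_add_div_rpow {S : Type*} [MeasurableSpace S] (θ ν : Measure S)
    [IsProbabilityMeasure θ] [IsProbabilityMeasure ν] {α : ℝ} (hα : 0 < α) :
    ∫⁻ x in {x | 0 < θ.rnDeriv (θ + ν) x ∧ 0 < ν.rnDeriv (θ + ν) x},
      (θ.rnDeriv (θ + ν) x / ν.rnDeriv (θ + ν) x) ^ α ∂ν = ∫⁻ x, θ.rnDeriv ν x ^ α ∂ν := by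
  have hθ : θ ≪ θ + ν := Measure.AbsolutelyContinuous.rfl.add_right _
  have hν : ν ≪ θ + ν := Measure.AbsolutelyContinuous.rfl.add_right' _
  have hms : MeasurableSet {x | 0 < θ.rnDeriv (θ + ν) x ∧ 0 < ν.rnDeriv (θ + ν) x} :=
    (measurableSet_lt measurable_const (Measure.measurable_rnDeriv _ _)).inter
      (measurableSet_lt measurable_const (Measure.measurable_rnDeriv _ _))
  rw [← lintegral_indicator hms]
  refine lintegral_congr_ae ?_
  filter_upwards [Measure.rnDeriv_eq_div hθ hν, Measure.rnDeriv_pos hν] with x hx hpos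
  rw [hx]
  by_cases h : 0 < θ.rnDeriv (θ + ν) x
  · rw [Set.indicator_of_mem]
    exact ⟨h, hpos⟩
  · rw [Set.indicator_of_notMem (fun hm ↦ h hm.1)]
    rw [not_lt, nonpos_iff_eq_zero] at h
    simp [h, hα]

lemma le_renyiDivAux {S : Type*} [MeasurableSpace S] (θ ν : Measure S)
    [IsProbabilityMeasure θ] [IsProbabilityMeasure ν] {α : ℝ} (hα0 : 0 < α) (hα1 : α ≠ 1)
    {g : S → ℝ} (hg : Measurable g) (hgbd : ∃ C : ℝ, ∀ x, |g x| ≤ C) :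
    (((α - 1)⁻¹ * Real.log (∫ x, Real.exp ((α - 1) * g x) ∂θ)
      - α⁻¹ * Real.log (∫ x, Real.exp (α * g x) ∂ν) : ℝ) : EReal) ≤ renyiDivAux α θ ν := by
  have hIA := integrable_exp_mul_of_bounded θ hg hgbd (α - 1)
  have hIB := integrable_exp_mul_of_bounded ν hg hgbd α
  have hA := integral_exp_pos hIA
  have hB := integral_exp_pos hIB
  have hAl := ofReal_integral_eq_lintegral_ofReal hIA (ae_of_all _ fun _ ↦ (Real.exp_pos _).le)
  have hBl := ofReal_integral_eq_lintegral_ofReal hIB (ae_of_all _ fun _ ↦ (Real.exp_pos _).le)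
  set A := ∫ x, Real.exp ((α - 1) * g x) ∂θ
  set B := ∫ x, Real.exp (α * g x) ∂ν
  have hmf : Measurable (θ.rnDeriv ν) := Measure.measurable_rnDeriv _ _
  unfold renyiDivAux
  split_ifs with hc
  · exact le_top
  rw [setLIntegral_rnDeriv_add_div_rpow θ ν hα0]
  rcases lt_or_gt_of_ne hα1 with h1 | h1
  · have hle : ∫⁻ x, θ.rnDeriv ν x ^ α ∂ν
        ≤ ENNReal.ofReal A ^ α * ENNReal.ofReal B ^ (1 - α) := by
      calc ∫⁻ x, θ.rnDeriv ν x ^ α ∂ν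
          = ∫⁻ x, (θ.rnDeriv ν x * ENNReal.ofReal (Real.exp ((α - 1) * g x))) ^ α
              * ENNReal.ofReal (Real.exp (α * g x)) ^ (1 - α) ∂ν := by
            refine lintegral_congr fun x ↦ ?_
            rw [ENNReal.mul_rpow_of_nonneg _ _ hα0.le, mul_assoc,
              ENNReal.ofReal_rpow_of_pos (Real.exp_pos _),
              ENNReal.ofReal_rpow_of_pos (Real.exp_pos _), ← ENNReal.ofReal_mul (by positivity),
              ← Real.exp_mul, ← Real.exp_mul, ← Real.exp_add,
              show (α - 1) * g x * α + α * g x * (1 - α) = 0 by ring]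
            simp
        _ ≤ (∫⁻ x, θ.rnDeriv ν x * ENNReal.ofReal (Real.exp ((α - 1) * g x)) ∂ν) ^ α
              * (∫⁻ x, ENNReal.ofReal (Real.exp (α * g x)) ∂ν) ^ (1 - α) :=
            ENNReal.lintegral_mul_norm_pow_le (by fun_prop) (by fun_prop) hα0.le (by linarith)
              (by ring)
        _ ≤ ENNReal.ofReal A ^ α * ENNReal.ofReal B ^ (1 - α) := by
            rw [hAl, hBl]
            refine mul_le_mul_left (ENNReal.rpow_le_rpow ?_ hα0.le) _
            have := lintegral_withDensity_eq_lintegral_mul ν hmf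
              (g := fun x ↦ ENNReal.ofReal (Real.exp ((α - 1) * g x))) (by fun_prop)
            simp only [Pi.mul_apply] at this
            rw [← this]
            exact lintegral_mono' (Measure.withDensity_rnDeriv_le θ ν) le_rfl
    have hlog := ENNReal.log_monotone hle
    rw [ENNReal.log_mul_add, ENNReal.log_rpow, ENNReal.log_rpow, ENNReal.log_ofReal_of_pos hA,
      ENNReal.log_ofReal_of_pos hB] at hlog
    have hneg : (α * (α - 1))⁻¹ < 0 := inv_lt_zero.2 (mul_neg_of_pos_of_neg hα0 (by linarith))
    generalize ENNReal.log (∫⁻ x, θ.rnDeriv ν x ^ α ∂ν) = h at hlog ⊢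
    induction h using EReal.rec with
    | bot => rw [EReal.coe_mul_bot_of_neg hneg]; exact le_top
    | top => exact absurd (top_le_iff.1 hlog) (by exact_mod_cast EReal.coe_ne_top _)
    | coe h =>
      norm_cast at hlog ⊢
      have := mul_le_mul_of_nonpos_left hlog hneg.le
      refine le_trans (le_of_eq ?_) this
      have : α - 1 ≠ 0 := sub_ne_zero.2 hα1
      field_simp
      ring
  · have hac : θ ≪ ν := by tauto
    have hle : ENNReal.ofReal A
        ≤ (∫⁻ x, θ.rnDeriv ν x ^ α ∂ν) ^ α⁻¹ * ENNReal.ofReal B ^ (1 - α⁻¹) := by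
      have hinv : α⁻¹ ≤ 1 := inv_le_one_of_one_le₀ h1.le
      calc ENNReal.ofReal A
          = ∫⁻ x, θ.rnDeriv ν x * ENNReal.ofReal (Real.exp ((α - 1) * g x)) ∂ν := by
            rw [hAl, lintegral_rnDeriv_mul hac (by fun_prop)]
        _ = ∫⁻ x, (θ.rnDeriv ν x ^ α) ^ α⁻¹
              * ENNReal.ofReal (Real.exp (α * g x)) ^ (1 - α⁻¹) ∂ν := by
            refine lintegral_congr fun x ↦ ?_
            rw [ENNReal.rpow_rpow_inv hα0.ne', ENNReal.ofReal_rpow_of_pos (Real.exp_pos _),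
              ← Real.exp_mul]
            congr 3
            field_simp
        _ ≤ _ := by
            rw [hBl]
            exact ENNReal.lintegral_mul_norm_pow_le (by fun_prop) (by fun_prop) (by positivity)
              (by linarith) (by ring)
    have hlog := ENNReal.log_monotone hle
    rw [ENNReal.log_mul_add, ENNReal.log_rpow, ENNReal.log_rpow, ENNReal.log_ofReal_of_pos hA,
      ENNReal.log_ofReal_of_pos hB] at hlog
    have hsub : 0 < α - 1 := by linarith
    have hpos : 0 < (α * (α - 1))⁻¹ := by positivity
    generalize ENNReal.log (∫⁻ x, θ.rnDeriv ν x ^ α ∂ν) = h at hlog ⊢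
    induction h using EReal.rec with
    | bot =>
      rw [EReal.coe_mul_bot_of_pos (by positivity), EReal.bot_add] at hlog
      exact absurd (le_bot_iff.1 hlog) (EReal.coe_ne_bot _)
    | top => rw [EReal.coe_mul_top_of_pos hpos]; exact le_top
    | coe h =>
      norm_cast at hlog ⊢
      have := mul_le_mul_of_nonneg_left hlog (inv_pos.2 hsub).le
      have e : (α - 1)⁻¹ * (α⁻¹ * h + (1 - α⁻¹) * Real.log B)
          = (α * (α - 1))⁻¹ * h + α⁻¹ * Real.log B := by field_simp
      linarith

lemma renyiDivAux_tilted {S : Type*} [MeasurableSpace S] (ν : Measure S)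
    [IsProbabilityMeasure ν] {α : ℝ} (hα0 : 0 < α) (hα1 : α ≠ 1)
    {g : S → ℝ} (hg : Measurable g) (hgbd : ∃ C : ℝ, ∀ x, |g x| ≤ C) :
    renyiDivAux α (ν.tilted g) ν =
      (((α - 1)⁻¹ * Real.log (∫ x, Real.exp ((α - 1) * g x) ∂ν.tilted g)
      - α⁻¹ * Real.log (∫ x, Real.exp (α * g x) ∂ν) : ℝ) : EReal) := by
  have hIZ : Integrable (fun x ↦ Real.exp (g x)) ν := by
    simpa using integrable_exp_mul_of_bounded ν hg hgbd 1
  have hIB := integrable_exp_mul_of_bounded ν hg hgbd α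
  have hZ := integral_exp_pos hIZ
  have hB := integral_exp_pos hIB
  have := isProbabilityMeasure_tilted hIZ
  have hH : ∫⁻ x, (ν.tilted g).rnDeriv ν x ^ α ∂ν
      = ENNReal.ofReal ((∫ x, Real.exp (α * g x) ∂ν) / (∫ x, Real.exp (g x) ∂ν) ^ α) := by
    rw [← integral_div, ofReal_integral_eq_lintegral_ofReal (hIB.div_const _)
      (ae_of_all _ fun _ ↦ by positivity)]
    refine lintegral_congr_ae ?_
    filter_upwards [rnDeriv_tilted_left_self hg.aemeasurable] with x hx
    rw [hx, ENNReal.ofReal_rpow_of_pos (by positivity),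
      Real.div_rpow (Real.exp_pos _).le hZ.le, ← Real.exp_mul, mul_comm α]
  have hA : ∫ x, Real.exp ((α - 1) * g x) ∂ν.tilted g
      = (∫ x, Real.exp (α * g x) ∂ν) / ∫ x, Real.exp (g x) ∂ν := by
    rw [integral_exp_tilted]
    congr! 4 with x
    simp only [Pi.add_apply]
    ring
  rw [renyiDivAux, if_neg (fun h ↦ h.2 (tilted_absolutelyContinuous ν g)),
    setLIntegral_rnDeriv_add_div_rpow _ _ hα0, hH, ENNReal.log_ofReal_of_pos (by positivity), hA,
    Real.log_div hB.ne' (by positivity), Real.log_div hB.ne' hZ.ne', Real.log_rpow hZ]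
  norm_cast
  have : α - 1 ≠ 0 := sub_ne_zero.2 hα1
  field_simp
  ring

lemma le_renyiDiv {S : Type*} [MeasurableSpace S] (θ ν : Measure S)
    [IsProbabilityMeasure θ] [IsProbabilityMeasure ν] {α : ℝ} (hα0 : α ≠ 0) (hα1 : α ≠ 1)
    {g : S → ℝ} (hg : Measurable g) (hgbd : ∃ C : ℝ, ∀ x, |g x| ≤ C) :
    (((α - 1)⁻¹ * Real.log (∫ x, Real.exp ((α - 1) * g x) ∂θ)
      - α⁻¹ * Real.log (∫ x, Real.exp (α * g x) ∂ν) : ℝ) : EReal) ≤ renyiDiv α θ ν := by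
  unfold renyiDiv
  split_ifs with h
  · have := le_renyiDivAux ν θ (α := 1 - α) (by linarith) (by simpa using hα0) hg.neg
      (by simpa using hgbd)
    convert this using 2
    rw [show (1 - α - 1)⁻¹ = -α⁻¹ by rw [← inv_neg]; ring,
      show (1 - α)⁻¹ = -(α - 1)⁻¹ by rw [← inv_neg]; ring]
    simp only [Pi.neg_apply, show ∀ x, (1 - α - 1) * -g x = α * g x by intro x; ring,
      show ∀ x, (1 - α) * -g x = (α - 1) * g x by intro x; ring]
    ring
  · exact le_renyiDivAux θ ν (lt_of_le_of_ne (not_lt.1 h) hα0.symm) hα1 hg hgbd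

lemma renyiDiv_tilted {S : Type*} [MeasurableSpace S] (ν : Measure S)
    [IsProbabilityMeasure ν] {α : ℝ} (hα0 : α ≠ 0) (hα1 : α ≠ 1)
    {g : S → ℝ} (hg : Measurable g) (hgbd : ∃ C : ℝ, ∀ x, |g x| ≤ C) :
    renyiDiv α (ν.tilted g) ν =
      (((α - 1)⁻¹ * Real.log (∫ x, Real.exp ((α - 1) * g x) ∂ν.tilted g)
      - α⁻¹ * Real.log (∫ x, Real.exp (α * g x) ∂ν) : ℝ) : EReal) := by
  have hIZ : Integrable (fun x ↦ Real.exp (g x)) ν := by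
    simpa using integrable_exp_mul_of_bounded ν hg hgbd 1
  have := isProbabilityMeasure_tilted hIZ
  unfold renyiDiv
  split_ifs with h
  · have := renyiDivAux_tilted (ν.tilted g) (α := 1 - α) (by linarith) (by simpa using hα0) hg.neg
      (by simpa using hgbd)
    rw [tilted_neg_same hIZ] at this
    rw [this]
    congr 1
    rw [show (1 - α - 1)⁻¹ = -α⁻¹ by rw [← inv_neg]; ring,
      show (1 - α)⁻¹ = -(α - 1)⁻¹ by rw [← inv_neg]; ring]
    simp only [Pi.neg_apply, show ∀ x, (1 - α - 1) * -g x = α * g x by intro x; ring,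
      show ∀ x, (1 - α) * -g x = (α - 1) * g x by intro x; ring]
    ring
  · exact renyiDivAux_tilted ν (lt_of_le_of_ne (not_lt.1 h) hα0.symm) hα1 hg hgbd

/-- **Supremum representation, order-`α` form.** For a probability measure `ν`, `α ∈ ℝ \ {0,1}`,
and bounded measurable `g`,
`(1/α) log ∫ e^{αg} dν = sup_θ [ (1/(α-1)) log ∫ e^{(α-1)g} dθ - R_α(θ‖ν) ]`,
the supremum being over all probability measures `θ`. -/
theorem renyi_sup_representation_alpha {S : Type*} [MeasurableSpace S]
    (ν : Measure S) [IsProbabilityMeasure ν]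
    (α : ℝ) (hα0 : α ≠ 0) (hα1 : α ≠ 1)
    (g : S → ℝ) (hg : Measurable g) (hgbd : ∃ C : ℝ, ∀ x, |g x| ≤ C) :
    ((α⁻¹ * Real.log (∫ x, Real.exp (α * g x) ∂ν) : ℝ) : EReal) =
      ⨆ (θ : Measure S) (_ : IsProbabilityMeasure θ),
        (((α - 1)⁻¹ * Real.log (∫ x, Real.exp ((α - 1) * g x) ∂θ) : ℝ) : EReal)
          - renyiDiv α θ ν := by
  refine le_antisymm ?_ (iSup₂_le fun θ hθ ↦ ?_)
  · have hIZ : Integrable (fun x ↦ Real.exp (g x)) ν := by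
      simpa using integrable_exp_mul_of_bounded ν hg hgbd 1
    refine le_iSup₂_of_le (ν.tilted g) (isProbabilityMeasure_tilted hIZ) ?_
    rw [renyiDiv_tilted ν hα0 hα1 hg hgbd, ← EReal.coe_sub, sub_sub_cancel]
  · refine (EReal.sub_le_sub le_rfl (le_renyiDiv θ ν hα0 hα1 hg hgbd)).trans ?_
    rw [← EReal.coe_sub, sub_sub_cancel]
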